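/- Let I be a TAP instance, let k ≥ 1, and let I′ be the disjoint union of k copies of I (the applicant and school sets of I′ are k disjoint copies of those of I; each copied applicant has the copied type, finds acceptable exactly the copies of her acceptable schools within her own copy with the copied preference order, and each copied school has the copied capacities and preference order). Then: (1) I′ admits a stable matching if and only if I does; and (2) if I admits no stable matching, then every matching of I′ admits at least k blocking pairs. -/

import Mathlib

structure TAP (A : Type*) (S : Type*) (P : Type*) where
  ptype : A → Finset P
  prefA : A → List S
  cap : S → P → ℕ
  prefS : S → List A

namespace TAP

variable {A S P : Type*} [DecidableEq A] [DecidableEq S] [DecidableEq P] (J : TAP A S P)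

def WellFormed : Prop :=
  (∀ a, (J.ptype a).card = 2) ∧ (∀ a, (J.prefA a).Nodup) ∧
  (∀ s, (J.prefS s).Nodup) ∧ (∀ a s, a ∈ J.prefS s ↔ s ∈ J.prefA a)

def IsAssignment (M : Finset (A × S)) : Prop :=
  (∀ x ∈ M, x.2 ∈ J.prefA x.1) ∧
  ∀ a s s', (a, s) ∈ M → (a, s') ∈ M → s = s'

def Mp (M : Finset (A × S)) (s : S) (p : P) : Finset A :=
  (M.filter (fun x => x.2 = s ∧ p ∈ J.ptype x.1)).image Prod.fst

def Mpr (M : Finset (A × S)) (s : S) (p r : P) : Finset A :=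
  (M.filter (fun x => x.2 = s ∧ J.ptype x.1 = {p, r})).image Prod.fst

def IsMatching (M : Finset (A × S)) : Prop :=
  J.IsAssignment M ∧ ∀ s p, (J.Mp M s p).card ≤ J.cap s p

def Undersub (M : Finset (A × S)) (s : S) (p : P) : Prop :=
  (J.Mp M s p).card < J.cap s p

def PrefersA (a : A) (s s' : S) : Prop :=
  s ∈ J.prefA a ∧ s' ∈ J.prefA a ∧ (J.prefA a).idxOf s < (J.prefA a).idxOf s'

def PrefersS (s : S) (a a' : A) : Prop :=
  a ∈ J.prefS s ∧ a' ∈ J.prefS s ∧ (J.prefS s).idxOf a < (J.prefS s).idxOf a'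

def Unassigned (M : Finset (A × S)) (a : A) : Prop := ∀ s, (a, s) ∉ M

def Blocks (M : Finset (A × S)) (a : A) (s : S) : Prop :=
  s ∈ J.prefA a ∧
  (Unassigned M a ∨ ∃ s', (a, s') ∈ M ∧ J.PrefersA a s s') ∧
  ∃ p₁ p₂, p₁ ≠ p₂ ∧ J.ptype a = {p₁, p₂} ∧
    ((J.Undersub M s p₁ ∧ J.Undersub M s p₂) ∨
     (J.Undersub M s p₁ ∧ ∃ b ∈ J.Mp M s p₂, J.PrefersS s a b) ∨
     (J.Undersub M s p₂ ∧ ∃ b ∈ J.Mp M s p₁, J.PrefersS s a b) ∨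
     (∃ b ∈ J.Mpr M s p₁ p₂, J.PrefersS s a b) ∨
     (∃ b₁ ∈ J.Mp M s p₁, ∃ b₂ ∈ J.Mp M s p₂, b₁ ≠ b₂ ∧ J.PrefersS s a b₁ ∧ J.PrefersS s a b₂))

def Stable (M : Finset (A × S)) : Prop :=
  J.IsMatching M ∧ ∀ a s, ¬ J.Blocks M a s

end TAP
namespace TAP

/-- The disjoint union of `k` copies of a TAP instance. -/
def copies {A S P : Type*} (J : TAP A S P) (k : ℕ) : TAP (Fin k × A) (Fin k × S) P where
  ptype a := J.ptype a.2
  prefA a := (J.prefA a.2).map (fun s => (a.1, s))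
  cap s := J.cap s.2
  prefS s := (J.prefS s.2).map (fun a => (s.1, a))

end TAP

namespace TAP

variable {A S P : Type*}

/-- The part of an assignment of `J.copies k` lying in the `i`-th copy. -/
noncomputable def slice {k : ℕ} (M : Finset ((Fin k × A) × (Fin k × S))) (i : Fin k) :
    Finset (A × S) :=
  M.preimage (fun x => ((i, x.1), (i, x.2))) fun x _ y _ h => by
    simp only [Prod.mk.injEq, true_and] at h
    exact Prod.ext h.1 h.2

/-- The assignment of `J.copies k` given by `M` in each copy. -/
def replicate (k : ℕ) (M : Finset (A × S)) : Finset ((Fin k × A) × (Fin k × S)) :=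
  (Finset.univ ×ˢ M).map ⟨fun x => ((x.1, x.2.1), (x.1, x.2.2)), fun x y h => by
    simp only [Prod.mk.injEq] at h
    exact Prod.ext h.1.1 (Prod.ext h.1.2 h.2.2)⟩

section

variable {k : ℕ} {M : Finset ((Fin k × A) × (Fin k × S))} {i : Fin k}

@[simp]
theorem mem_slice {x : A × S} : x ∈ slice M i ↔ ((i, x.1), (i, x.2)) ∈ M :=
  Finset.mem_preimage

@[simp]
theorem mem_replicate {N : Finset (A × S)} {x : (Fin k × A) × (Fin k × S)} :
    x ∈ replicate k N ↔ x.1.1 = x.2.1 ∧ (x.1.2, x.2.2) ∈ N := by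
  obtain ⟨⟨i, a⟩, j, s⟩ := x
  simp only [replicate, Finset.mem_map, Finset.mem_product, Finset.mem_univ, true_and]
  constructor
  · rintro ⟨x, h, hx⟩
    cases hx
    exact ⟨rfl, h⟩
  · rintro ⟨h, hN⟩
    cases h
    exact ⟨(i, a, s), hN, rfl⟩

@[simp]
theorem slice_replicate (N : Finset (A × S)) : slice (replicate k N) i = N := by
  ext; simp

end

theorem idxOf_map_of_injective {α β : Type*} [DecidableEq α] [DecidableEq β] {f : α → β}
    (hf : Function.Injective f) (l : List α) (a : α) : (l.map f).idxOf (f a) = l.idxOf a := by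
  induction l with
  | nil => rfl
  | cons b l ih => simp [List.idxOf_cons, ih, hf.eq_iff, beq_eq_decide]

variable (J : TAP A S P) {k : ℕ} {M : Finset ((Fin k × A) × (Fin k × S))} {i j : Fin k}
  {a b : A} {s s' : S} {p q : P}

@[simp]
theorem mem_copies_prefA : (j, s) ∈ (J.copies k).prefA (i, a) ↔ i = j ∧ s ∈ J.prefA a := by
  simp [copies, and_comm]

@[simp]
theorem mem_copies_prefS : (j, a) ∈ (J.copies k).prefS (i, s) ↔ i = j ∧ a ∈ J.prefS s := by
  simp [copies, and_comm]

theorem copies_prefersA [DecidableEq S] :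
    (J.copies k).PrefersA (i, a) (i, s) (i, s') ↔ J.PrefersA a s s' := by
  simp only [PrefersA, mem_copies_prefA, true_and]
  simp only [copies, idxOf_map_of_injective (Prod.mk_right_injective i)]

theorem copies_prefersS [DecidableEq A] :
    (J.copies k).PrefersS (i, s) (i, a) (i, b) ↔ J.PrefersS s a b := by
  simp only [PrefersS, mem_copies_prefS, true_and]
  simp only [copies, idxOf_map_of_injective (Prod.mk_right_injective i)]

theorem unassigned_slice (hM : ∀ x ∈ M, x.1.1 = x.2.1) :
    Unassigned (slice M i) a ↔ Unassigned M (i, a) := by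
  simp only [Unassigned, mem_slice, Prod.forall]
  refine ⟨fun h j s hs => ?_, fun h s => h i s⟩
  obtain rfl : i = j := hM _ hs
  exact h s hs

variable [DecidableEq A] [DecidableEq S] [DecidableEq P]

theorem mem_Mp {N : Finset (A × S)} : a ∈ J.Mp N s p ↔ (a, s) ∈ N ∧ p ∈ J.ptype a := by
  simp [Mp]

theorem mem_Mpr {N : Finset (A × S)} :
    a ∈ J.Mpr N s p q ↔ (a, s) ∈ N ∧ J.ptype a = {p, q} := by
  simp [Mpr]

theorem copies_Mp (hM : ∀ x ∈ M, x.1.1 = x.2.1) :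
    (J.copies k).Mp M (i, s) p = (J.Mp (slice M i) s p).map (.sectR i A) := by
  ext ⟨j, a⟩
  simp only [mem_Mp, Finset.mem_map, mem_slice, Function.Embedding.sectR_apply, Prod.mk.injEq]
  constructor
  · rintro ⟨h, hp⟩
    obtain rfl : j = i := hM _ h
    exact ⟨a, ⟨h, hp⟩, rfl, rfl⟩
  · rintro ⟨_, h, rfl, rfl⟩
    exact h

theorem copies_Mpr (hM : ∀ x ∈ M, x.1.1 = x.2.1) :
    (J.copies k).Mpr M (i, s) p q = (J.Mpr (slice M i) s p q).map (.sectR i A) := by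
  ext ⟨j, a⟩
  simp only [mem_Mpr, Finset.mem_map, mem_slice, Function.Embedding.sectR_apply, Prod.mk.injEq]
  constructor
  · rintro ⟨h, hp⟩
    obtain rfl : j = i := hM _ h
    exact ⟨a, ⟨h, hp⟩, rfl, rfl⟩
  · rintro ⟨_, h, rfl, rfl⟩
    exact h

theorem copies_blocks (hM : ∀ x ∈ M, x.1.1 = x.2.1) :
    (J.copies k).Blocks M (i, a) (i, s) ↔ J.Blocks (slice M i) a s := by
  have hA : (∃ t, ((i, a), t) ∈ M ∧ (J.copies k).PrefersA (i, a) (i, s) t) ↔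
      ∃ t, (a, t) ∈ slice M i ∧ J.PrefersA a s t := by
    simp only [Prod.exists, mem_slice]
    constructor
    · rintro ⟨j, t, ht, h⟩
      obtain rfl : i = j := hM _ ht
      exact ⟨t, ht, J.copies_prefersA.1 h⟩
    · rintro ⟨t, ht, h⟩
      exact ⟨i, t, ht, J.copies_prefersA.2 h⟩
  have hp : (J.copies k).ptype (i, a) = J.ptype a := rfl
  have hc (p : P) : (J.copies k).cap (i, s) p = J.cap s p := rfl
  simp only [Blocks, hA, hp, hc, Undersub, J.copies_Mp hM, J.copies_Mpr hM, Finset.card_map,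
    mem_copies_prefA, true_and, unassigned_slice hM, Finset.mem_map, exists_exists_and_eq_and,
    Function.Embedding.sectR_apply, copies_prefersS, Ne, Prod.mk.injEq]

theorem copies_isMatching :
    (J.copies k).IsMatching M ↔
      (∀ x ∈ M, x.1.1 = x.2.1) ∧ ∀ i, J.IsMatching (slice M i) := by
  have hc (i : Fin k) (s : S) (p : P) : (J.copies k).cap (i, s) p = J.cap s p := rfl
  constructor
  · rintro ⟨⟨hacc, hfun⟩, hcap⟩
    have hM : ∀ x ∈ M, x.1.1 = x.2.1 := fun x hx => ((J.mem_copies_prefA).1 (hacc x hx)).1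
    refine ⟨hM, fun i => ⟨⟨fun x hx => ?_, fun a s s' h h' => ?_⟩, fun s p => ?_⟩⟩
    · exact ((J.mem_copies_prefA).1 (hacc _ (mem_slice.1 hx))).2
    · exact congrArg Prod.snd (hfun (i, a) (i, s) (i, s') (mem_slice.1 h) (mem_slice.1 h'))
    · simpa [J.copies_Mp hM, hc] using hcap (i, s) p
  · rintro ⟨hM, h⟩
    refine ⟨⟨?_, ?_⟩, fun ⟨i, s⟩ p => ?_⟩
    · rintro ⟨⟨i, a⟩, j, s⟩ hx
      obtain rfl : i = j := hM _ hx
      exact (J.mem_copies_prefA).2 ⟨rfl, (h i).1.1 (a, s) (mem_slice.2 hx)⟩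
    · rintro ⟨i, a⟩ ⟨j, s⟩ ⟨j', s'⟩ hx hx'
      obtain rfl : i = j := hM _ hx
      obtain rfl : i = j' := hM _ hx'
      exact congrArg _ ((h i).1.2 a s s' (mem_slice.2 hx) (mem_slice.2 hx'))
    · simpa [J.copies_Mp hM, hc] using (h i).2 s p

theorem copies_stable :
    (J.copies k).Stable M ↔ (∀ x ∈ M, x.1.1 = x.2.1) ∧ ∀ i, J.Stable (slice M i) := by
  constructor
  · rintro ⟨hm, hb⟩
    obtain ⟨hM, h⟩ := J.copies_isMatching.1 hm
    exact ⟨hM, fun i => ⟨h i, fun a s hs => hb _ _ ((J.copies_blocks hM).2 hs)⟩⟩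
  · rintro ⟨hM, h⟩
    refine ⟨J.copies_isMatching.2 ⟨hM, fun i => (h i).1⟩, ?_⟩
    rintro ⟨i, a⟩ ⟨j, s⟩ hb
    obtain rfl : i = j := ((J.mem_copies_prefA).1 hb.1).1
    exact (h i).2 a s ((J.copies_blocks hM).1 hb)

end TAP

theorem stmt16 {A S P : Type*} [DecidableEq A] [DecidableEq S] [DecidableEq P]
    [Fintype A] [Fintype S]
    (J : TAP A S P) (k : ℕ) (hk : 1 ≤ k) :
    ((∃ M, (J.copies k).Stable M) ↔ ∃ M, J.Stable M) ∧
    ((¬ ∃ M, J.Stable M) → ∀ M : Finset ((Fin k × A) × (Fin k × S)),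
      (J.copies k).IsMatching M →
      k ≤ {bp : (Fin k × A) × (Fin k × S) | (J.copies k).Blocks M bp.1 bp.2}.ncard) := by
  refine ⟨⟨fun ⟨M, hM⟩ => ⟨_, (J.copies_stable.1 hM).2 ⟨0, hk⟩⟩, fun ⟨M, hM⟩ =>
    ⟨TAP.replicate k M, J.copies_stable.2 ⟨fun x hx => (TAP.mem_replicate.1 hx).1, fun i => ?_⟩⟩⟩,
    fun hJ M hM => ?_⟩
  · rwa [TAP.slice_replicate]
  obtain ⟨hloc, hmatch⟩ := J.copies_isMatching.1 hM
  have hblock (i : Fin k) : ∃ x : A × S, J.Blocks (TAP.slice M i) x.1 x.2 := by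
    by_contra! h
    exact hJ ⟨_, hmatch i, fun a s => h (a, s)⟩
  choose f hf using hblock
  let g (i : Fin k) : (Fin k × A) × (Fin k × S) := ((i, (f i).1), (i, (f i).2))
  have hg : Function.Injective g := fun i j h => congrArg (fun x => x.1.1) h
  calc k = (Set.range g).ncard := by
        rw [← Set.image_univ, Set.ncard_image_of_injective _ hg, Set.ncard_univ, Nat.card_fin]
    _ ≤ _ := by
        refine Set.ncard_le_ncard ?_ (Set.toFinite _)
        rintro _ ⟨i, rfl⟩
        exact (J.copies_blocks hloc).2 (hf i)
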